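/- arXiv:0706.4158 — 2 statements merged into one kernel-verified Lean document; each statement's English description precedes it below -/
import Mathlib

section
/- Let c>0, let c_1,…,c_N>0 be fixed, let κ≥1 and μ>0. Then there exists a constant C>0, depending only on κ, μ, c and c_1,…,c_N, such that the following holds: if G:[0,∞)×ℝ³→ℝ is smooth and u is a smooth solution of ∂_t²u−c²Δ_x u=G on (0,∞)×ℝ³ with u(0,·)=0 and ∂_t u(0,·)=0, then for every (t,x)∈[0,∞)×ℝ³, ⟨t+|x|⟩·Φ_{κ−1}(ct,|x|)^{−1}·|u(t,x)| ≤ C·A_{κ,μ,0}[G;c](t,x), where Φ_ρ(t,r)=log(2+⟨t+r⟩⟨t−r⟩^{−1}) if ρ=0 and Φ_ρ(t,r)=⟨t−r⟩^{−ρ} if ρ>0. -/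
noncomputable section

namespace PaperKatayama

/-- Euclidean 3-space. -/
abbrev E3 := EuclideanSpace ℝ (Fin 3)

/-- Space-time functions. -/
abbrev Fn := ℝ → E3 → ℝ

/-- Functions of the space variable alone. -/
abbrev SFn := E3 → ℝ

/-- The Japanese bracket `⟨a⟩ = √(1+a²)`. -/
def jb (a : ℝ) : ℝ := Real.sqrt (1 + a ^ 2)

/-- Time derivative `∂_t`. -/
def pt (f : Fn) : Fn := fun t x => deriv (fun s => f s x) t

/-- Spatial derivative `∂_j` (j = 1,2,3, here indexed by `Fin 3`). -/
def pd (j : Fin 3) (f : Fn) : Fn :=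
  fun t x => fderiv ℝ (f t) x (EuclideanSpace.single j 1)

/-- `∂_a` for `a ∈ {0,1,2,3}`, with `∂_0 = ∂_t`. -/
def pda (a : Fin 4) : Fn → Fn := Fin.cases pt (fun j => pd j) a

/-- Rotation field `Ω_{jk} = x_j ∂_k − x_k ∂_j`, extended antisymmetrically
(so `rotA k j = − rotA j k`, and `rotA j j = 0`). -/
def rotA (j k : Fin 3) (f : Fn) : Fn :=
  fun t x => x j * pd k f t x - x k * pd j f t x

/-- Radial derivative `∂_r = Σ_j (x_j/r) ∂_j`. -/
def pr (f : Fn) : Fn := fun t x => ∑ j, (x j / ‖x‖) * pd j f t x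

/-- `D_{+,c} = ∂_t + c ∂_r`. -/
def Dp (c : ℝ) (f : Fn) : Fn := fun t x => pt f t x + c * pr f t x

/-- `D_{−,c} = ∂_t − c ∂_r`. -/
def Dm (c : ℝ) (f : Fn) : Fn := fun t x => pt f t x - c * pr f t x

/-- The seven fields `Z = {∂_t, ∂_1, ∂_2, ∂_3, Ω_{12}, Ω_{13}, Ω_{23}}`. -/
def Zop : Fin 7 → Fn → Fn :=
  ![pt, pd 0, pd 1, pd 2, rotA 0 1, rotA 0 2, rotA 1 2]

/-- `Z^α = Z_1^{α_1} ⋯ Z_7^{α_7}`. -/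
def Zpow (α : Fin 7 → ℕ) (f : Fn) : Fn :=
  (Zop 0)^[α 0] <| (Zop 1)^[α 1] <| (Zop 2)^[α 2] <| (Zop 3)^[α 3] <|
    (Zop 4)^[α 4] <| (Zop 5)^[α 5] <| (Zop 6)^[α 6] f

/-- Multi-indices `α` (for the seven fields) with `|α| ≤ s`. -/
def multiIdx (s : ℕ) : Finset (Fin 7 → ℕ) :=
  (Fintype.piFinset fun _ => Finset.range (s + 1)).filter fun α => ∑ i, α i ≤ s

/-- `|v(t,x)|_s = Σ_{|α| ≤ s} |Z^α v(t,x)|`. -/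
def vnorm (s : ℕ) (f : Fn) (t : ℝ) (x : E3) : ℝ :=
  ∑ α ∈ multiIdx s, |Zpow α f t x|

/-- Smoothness of a space-time function. -/
def Smooth (f : Fn) : Prop := ContDiff ℝ (⊤ : ℕ∞) (fun p : ℝ × E3 => f p.1 p.2)

/-- `u` is a smooth solution of `∂_t²u − c²Δu = G` on `(0,∞)×ℝ³`
with zero initial data. -/
def IsWaveSol (c : ℝ) (G u : Fn) : Prop :=
  Smooth u ∧
    (∀ t x, 0 < t → pt (pt u) t x - c ^ 2 * ∑ j, pd j (pd j u) t x = G t x) ∧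
    (∀ x, u 0 x = 0) ∧ (∀ x, pt u 0 x = 0)

/-- `u` is a smooth solution of the free wave equation `∂_t²u − c²Δu = 0`
on `(0,∞)×ℝ³` with initial data `φ, ψ`. -/
def IsFreeWaveSol (c : ℝ) (φ ψ : SFn) (u : Fn) : Prop :=
  Smooth u ∧
    (∀ t x, 0 < t → pt (pt u) t x - c ^ 2 * ∑ j, pd j (pd j u) t x = 0) ∧
    (∀ x, u 0 x = φ x) ∧ (∀ x, pt u 0 x = ψ x)

/-- Extension of the speeds `c_1, …, c_N` by `c_0 = 0`. -/
def cs0 {N : ℕ} (cs : Fin N → ℝ) : Fin (N + 1) → ℝ := Fin.cases 0 cs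

/-- The weight `w(t,r) = min_{0 ≤ j ≤ N} ⟨c_j t − r⟩` (with `c_0 = 0`). -/
def wgt {N : ℕ} (cs : Fin N → ℝ) (t r : ℝ) : ℝ :=
  Finset.univ.inf' Finset.univ_nonempty fun j : Fin (N + 1) => jb (cs0 cs j * t - r)

/-- The weighted sup `A_{ρ,μ,s}[G;c](t,x)` over the backward cone `Λ_c(t,x)`. -/
def Afun (ρ μ : ℝ) (s : ℕ) (G : Fn) (c : ℝ) {N : ℕ} (cs : Fin N → ℝ)
    (t : ℝ) (x : E3) : ℝ :=
  sSup {a : ℝ | ∃ τ : ℝ, ∃ y : E3, 0 ≤ τ ∧ τ ≤ t ∧ ‖y - x‖ ≤ c * (t - τ) ∧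
    a = ‖y‖ * jb (τ + ‖y‖) ^ ρ * wgt cs τ ‖y‖ ^ (1 + μ) * vnorm s G τ y}

/-- Spatial derivative of a function of `x` alone. -/
def sd (j : Fin 3) (φ : SFn) : SFn :=
  fun x => fderiv ℝ φ x (EuclideanSpace.single j 1)

/-- Spatial rotation field for functions of `x` alone. -/
def srot (j k : Fin 3) (φ : SFn) : SFn :=
  fun x => x j * sd k φ x - x k * sd j φ x

/-- The six spatial fields `{∂_1, ∂_2, ∂_3, Ω_{12}, Ω_{13}, Ω_{23}}`. -/
def Sop : Fin 6 → SFn → SFn :=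
  ![sd 0, sd 1, sd 2, srot 0 1, srot 0 2, srot 1 2]

/-- `Z^α` for the spatial fields. -/
def Spow (α : Fin 6 → ℕ) (φ : SFn) : SFn :=
  (Sop 0)^[α 0] <| (Sop 1)^[α 1] <| (Sop 2)^[α 2] <| (Sop 3)^[α 3] <|
    (Sop 4)^[α 4] <| (Sop 5)^[α 5] φ

/-- Spatial multi-indices with `|α| ≤ s`. -/
def smultiIdx (s : ℕ) : Finset (Fin 6 → ℕ) :=
  (Fintype.piFinset fun _ => Finset.range (s + 1)).filter fun α => ∑ i, α i ≤ s

/-- `|φ(x)|_s` for a function of `x` alone. -/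
def snorm (s : ℕ) (φ : SFn) (x : E3) : ℝ :=
  ∑ α ∈ smultiIdx s, |Spow α φ x|

/-- The weighted sup `B_{ρ,s}[φ,ψ;c](t,x)`. -/
def Bfun (ρ : ℝ) (s : ℕ) (φ ψ : SFn) (c t : ℝ) (x : E3) : ℝ :=
  sSup {b : ℝ | ∃ y : E3, ‖y - x‖ ≤ c * t ∧
    b = jb ‖y‖ ^ ρ * (snorm (s + 1) φ y + snorm s ψ y)}

/-- `Φ_ρ(t,r)`. -/
def Phi (ρ t r : ℝ) : ℝ :=
  if ρ = 0 then Real.log (2 + jb (t + r) / jb (t - r)) else jb (t - r) ^ (-ρ)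

/-- `Ψ_ρ(t)`. -/
def Psi (ρ t : ℝ) : ℝ := if ρ = 0 then Real.log (2 + t) else 1

/-- The null form `Q_0(v,w;c) = (∂_t v)(∂_t w) − c²(∇v)·(∇w)`. -/
def Q0f (c : ℝ) (v w : Fn) : Fn :=
  fun t x => pt v t x * pt w t x - c ^ 2 * ∑ j, pd j v t x * pd j w t x

/-- The null form `Q_{ab}(v,w) = (∂_a v)(∂_b w) − (∂_b v)(∂_a w)`. -/
def Qab (a b : Fin 4) (v w : Fn) : Fn :=
  fun t x => pda a v t x * pda b w t x - pda b v t x * pda a w t x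

/-- Lorentz boost `L_{c,j} = (x_j/c)∂_t + c t ∂_j`. -/
def Lb (c : ℝ) (j : Fin 3) (f : Fn) : Fn :=
  fun t x => (x j / c) * pt f t x + c * t * pd j f t x

/-- Scaling field `S = t ∂_t + x·∇_x`. -/
def Sc (f : Fn) : Fn := fun t x => t * pt f t x + ∑ j, x j * pd j f t x

/-- `v(t,r,ω) = r u(t, rω)`. -/
def Vrad (u : Fn) (ω : E3) (t r : ℝ) : ℝ := r * u t (r • ω)

/-- `(∂_t + ∂_r) v` in the variables `(t,r)` for fixed `ω`. -/
def DpV (u : Fn) (ω : E3) (t r : ℝ) : ℝ :=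
  deriv (fun s => Vrad u ω s r) t + deriv (fun ρ' => Vrad u ω t ρ') r

/-- Cross product in ℝ³. -/
def cross3 (a b : Fin 3 → ℝ) : Fin 3 → ℝ :=
  ![a 1 * b 2 - a 2 * b 1, a 2 * b 0 - a 0 * b 2, a 0 * b 1 - a 1 * b 0]

/-- `Ωv = (Ω_{23}v, −Ω_{13}v, Ω_{12}v)`. -/
def OmegaVec (v : Fn) (t : ℝ) (x : E3) : Fin 3 → ℝ :=
  ![rotA 1 2 v t x, -(rotA 0 2 v t x), rotA 0 1 v t x]

/-- `∂^α` for a multi-index with `|α| ≤ 1`: either the identity or a single `∂_a`. -/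
def Dle1 : Option (Fin 4) → Fn → Fn
  | none => id
  | some a => pda a

/-- A linear combination, with constant real coefficients, of the null forms
`Q_0(u_j, ∂^α u_k; c)` and `Q_{ab}(u_j, ∂^α u_k)` with `0 ≤ a < b ≤ 3`, `|α| ≤ 1`. -/
def NullF (c : ℝ) (m : ℕ)
    (a0 : Fin m → Fin m → Fin m → Option (Fin 4) → ℝ)
    (aQ : Fin m → Fin m → Fin m → Fin 4 → Fin 4 → Option (Fin 4) → ℝ)
    (v : Fin m → Fn) (i : Fin m) : Fn := fun t x =>
  (∑ j, ∑ k, ∑ o : Option (Fin 4), a0 i j k o * Q0f c (v j) (Dle1 o (v k)) t x) +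
    ∑ j, ∑ k, ∑ p ∈ Finset.univ.filter (fun p : Fin 4 × Fin 4 => p.1 < p.2),
      ∑ o : Option (Fin 4), aQ i j k p.1 p.2 o * Qab p.1 p.2 (v j) (Dle1 o (v k)) t x

open MeasureTheory intervalIntegral Set

theorem integral_integral_swap_of_continuous {f : ℝ → ℝ → ℝ}
    (hf : Continuous fun p : ℝ × ℝ => f p.1 p.2) (a b c d : ℝ) :
    ∫ x in a..b, ∫ y in c..d, f x y = ∫ y in c..d, ∫ x in a..b, f x y := by
  apply intervalIntegral_intervalIntegral_swap
  exact (hf.continuousOn.integrableOn_compact (isCompact_uIcc.prod isCompact_uIcc)).mono_set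
    (prod_mono uIoc_subset_uIcc uIoc_subset_uIcc)

/-- Divergence theorem on a box, when the flux through the faces in the second
and third directions cancels. -/
theorem integral_divergence_box {P Q R P' Q' R' : ℝ → ℝ → ℝ → ℝ} {T a b : ℝ}
    (hP : ∀ s φ θ, HasDerivAt (fun s => P s φ θ) (P' s φ θ) s)
    (hQ : ∀ s φ θ, HasDerivAt (fun φ => Q s φ θ) (Q' s φ θ) φ)
    (hR : ∀ s φ θ, HasDerivAt (fun θ => R s φ θ) (R' s φ θ) θ)
    (cP : Continuous fun p : ℝ × ℝ × ℝ => P' p.1 p.2.1 p.2.2)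
    (cQ : Continuous fun p : ℝ × ℝ × ℝ => Q' p.1 p.2.1 p.2.2)
    (cR : Continuous fun p : ℝ × ℝ × ℝ => R' p.1 p.2.1 p.2.2)
    (bQ : ∀ s θ, Q s a θ = Q s 0 θ) (bR : ∀ s φ, R s φ b = R s φ 0) :
    ∫ s in (0 : ℝ)..T, ∫ φ in (0 : ℝ)..a, ∫ θ in (0 : ℝ)..b, (P' s φ θ + Q' s φ θ + R' s φ θ) =
      ∫ φ in (0 : ℝ)..a, ∫ θ in (0 : ℝ)..b, (P T φ θ - P 0 φ θ) := by
  have cP1 (s φ : ℝ) : Continuous fun θ => P' s φ θ :=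
    cP.comp (by fun_prop : Continuous fun θ : ℝ => (s, φ, θ))
  have cQ1 (s φ : ℝ) : Continuous fun θ => Q' s φ θ :=
    cQ.comp (by fun_prop : Continuous fun θ : ℝ => (s, φ, θ))
  have cR1 (s φ : ℝ) : Continuous fun θ => R' s φ θ :=
    cR.comp (by fun_prop : Continuous fun θ : ℝ => (s, φ, θ))
  have cP2 : Continuous fun p : ℝ × ℝ => ∫ θ in (0 : ℝ)..b, P' p.1 p.2 θ :=
    continuous_parametric_intervalIntegral_of_continuous' (f := fun (p : ℝ × ℝ) θ => P' p.1 p.2 θ)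
      (cP.comp (by fun_prop : Continuous fun q : (ℝ × ℝ) × ℝ => (q.1.1, q.1.2, q.2))) 0 b
  have cQ2 : Continuous fun p : ℝ × ℝ => ∫ θ in (0 : ℝ)..b, Q' p.1 p.2 θ :=
    continuous_parametric_intervalIntegral_of_continuous' (f := fun (p : ℝ × ℝ) θ => Q' p.1 p.2 θ)
      (cQ.comp (by fun_prop : Continuous fun q : (ℝ × ℝ) × ℝ => (q.1.1, q.1.2, q.2))) 0 b
  have hRz (s φ : ℝ) : ∫ θ in (0 : ℝ)..b, R' s φ θ = 0 := by
    rw [integral_eq_sub_of_hasDerivAt (fun θ _ => hR s φ θ) ((cR1 s φ).intervalIntegrable _ _),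
      bR, sub_self]
  have hQz (s : ℝ) : ∫ φ in (0 : ℝ)..a, ∫ θ in (0 : ℝ)..b, Q' s φ θ = 0 := by
    rw [integral_integral_swap_of_continuous
      (cQ.comp (by fun_prop : Continuous fun q : ℝ × ℝ => (s, q.1, q.2)))]
    rw [integral_congr (g := fun _ => 0)]
    · simp
    intro θ _
    beta_reduce
    rw [integral_eq_sub_of_hasDerivAt (fun φ _ => hQ s φ θ), bQ, sub_self]
    exact (cQ.comp (by fun_prop : Continuous fun φ : ℝ => (s, φ, θ))).intervalIntegrable _ _
  have split (s φ : ℝ) : ∫ θ in (0 : ℝ)..b, (P' s φ θ + Q' s φ θ + R' s φ θ) =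
      (∫ θ in (0 : ℝ)..b, P' s φ θ) + ∫ θ in (0 : ℝ)..b, Q' s φ θ := by
    rw [intervalIntegral.integral_add, intervalIntegral.integral_add, hRz, add_zero]
    all_goals apply Continuous.intervalIntegrable
    exacts [cP1 s φ, cQ1 s φ, (cP1 s φ).add (cQ1 s φ), cR1 s φ]
  have split' (s : ℝ) :
      ∫ φ in (0 : ℝ)..a, ∫ θ in (0 : ℝ)..b, (P' s φ θ + Q' s φ θ + R' s φ θ) =
        ∫ φ in (0 : ℝ)..a, ∫ θ in (0 : ℝ)..b, P' s φ θ := by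
    simp only [split]
    rw [intervalIntegral.integral_add, hQz, add_zero]
    all_goals apply Continuous.intervalIntegrable
    · exact cP2.comp (by fun_prop : Continuous fun φ : ℝ => (s, φ))
    · exact cQ2.comp (by fun_prop : Continuous fun φ : ℝ => (s, φ))
  simp only [split']
  rw [integral_integral_swap_of_continuous cP2]
  refine integral_congr fun φ _ => ?_
  rw [integral_integral_swap_of_continuous
    (cP.comp (by fun_prop : Continuous fun q : ℝ × ℝ => (q.1, φ, q.2)))]
  refine integral_congr fun θ _ => ?_
  exact integral_eq_sub_of_hasDerivAt (fun s _ => hP s φ θ)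
    ((cP.comp (by fun_prop : Continuous fun s : ℝ => (s, φ, θ))).intervalIntegrable _ _)

/-- The unit vector with spherical coordinates `φ, θ` in the frame `b`. -/
def sph (b : OrthonormalBasis (Fin 3) ℝ E3) (φ θ : ℝ) : E3 :=
  (Real.sin φ * Real.cos θ) • b 0 + (Real.sin φ * Real.sin θ) • b 1 + Real.cos φ • b 2

/-- The polar derivative of `sph`. -/
def sphPolar (b : OrthonormalBasis (Fin 3) ℝ E3) (φ θ : ℝ) : E3 :=
  (Real.cos φ * Real.cos θ) • b 0 + (Real.cos φ * Real.sin θ) • b 1 - Real.sin φ • b 2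

/-- The normalized azimuthal derivative of `sph`. -/
def sphAzim (b : OrthonormalBasis (Fin 3) ℝ E3) (θ : ℝ) : E3 :=
  (-Real.sin θ) • b 0 + Real.cos θ • b 1

section

variable (b : OrthonormalBasis (Fin 3) ℝ E3)

theorem continuous_sph : Continuous fun p : ℝ × ℝ × ℝ => sph b p.2.1 p.2.2 := by
  unfold sph; fun_prop

theorem continuous_sphPolar : Continuous fun p : ℝ × ℝ × ℝ => sphPolar b p.2.1 p.2.2 := by
  unfold sphPolar; fun_prop

theorem continuous_sphAzim : Continuous fun p : ℝ × ℝ × ℝ => sphAzim b p.2.2 := by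
  unfold sphAzim; fun_prop

theorem hasDerivAt_sph_polar (φ θ : ℝ) :
    HasDerivAt (fun φ => sph b φ θ) (sphPolar b φ θ) φ := by
  unfold sph sphPolar
  have h1 := (((Real.hasDerivAt_sin φ).mul_const (Real.cos θ)).smul_const (b 0)).add
    (((Real.hasDerivAt_sin φ).mul_const (Real.sin θ)).smul_const (b 1))
  convert! h1.add ((Real.hasDerivAt_cos φ).smul_const (b 2)) using 1
  module

theorem hasDerivAt_sph_azim (φ θ : ℝ) :
    HasDerivAt (fun θ => sph b φ θ) (Real.sin φ • sphAzim b θ) θ := by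
  unfold sph sphAzim
  have h1 := (((Real.hasDerivAt_cos θ).const_mul (Real.sin φ)).smul_const (b 0)).add
    (((Real.hasDerivAt_sin θ).const_mul (Real.sin φ)).smul_const (b 1))
  convert! h1.add_const (Real.cos φ • b 2) using 1
  module

theorem hasDerivAt_sphPolar (φ θ : ℝ) :
    HasDerivAt (fun φ => sphPolar b φ θ) (-sph b φ θ) φ := by
  unfold sph sphPolar
  have h1 := (((Real.hasDerivAt_cos φ).mul_const (Real.cos θ)).smul_const (b 0)).add
    (((Real.hasDerivAt_cos φ).mul_const (Real.sin θ)).smul_const (b 1))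
  convert! h1.sub ((Real.hasDerivAt_sin φ).smul_const (b 2)) using 1
  module

theorem hasDerivAt_sphAzim (φ θ : ℝ) :
    HasDerivAt (fun θ => sphAzim b θ)
      (-(Real.sin φ • sph b φ θ + Real.cos φ • sphPolar b φ θ)) θ := by
  unfold sphAzim sph sphPolar
  have h1 := ((Real.hasDerivAt_sin θ).neg.smul_const (b 0)).add
    ((Real.hasDerivAt_cos θ).smul_const (b 1))
  convert! h1 using 1
  have h := Real.sin_sq_add_cos_sq φ
  have hs : Real.cos φ ^ 2 = 1 - Real.sin φ ^ 2 := by linarith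
  match_scalars <;> ring_nf <;> rw [hs] <;> ring

theorem sum_bilin_orthonormalBasis {ι ι' : Type*} [Fintype ι] [Fintype ι'] {E : Type*}
    [NormedAddCommGroup E] [InnerProductSpace ℝ E] [FiniteDimensional ℝ E]
    (v : OrthonormalBasis ι ℝ E) (w : OrthonormalBasis ι' ℝ E)
    (B : E →ₗ[ℝ] E →ₗ[ℝ] ℝ) : ∑ i, B (v i) (v i) = ∑ i, B (w i) (w i) := by
  have h := congrArg (TensorProduct.lift B)
    ((InnerProductSpace.canonicalCovariantTensor_eq_sum E v).symm.trans
      (InnerProductSpace.canonicalCovariantTensor_eq_sum E w))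
  simpa using h

theorem bilin_sph_frame (B : E3 →ₗ[ℝ] E3 →ₗ[ℝ] ℝ) (φ θ : ℝ) :
    B (sph b φ θ) (sph b φ θ) + B (sphPolar b φ θ) (sphPolar b φ θ) +
      B (sphAzim b θ) (sphAzim b θ) = ∑ i, B (b i) (b i) := by
  simp only [sph, sphPolar, sphAzim, Fin.sum_univ_three, map_add, map_sub, map_smul,
    LinearMap.add_apply, LinearMap.sub_apply, LinearMap.smul_apply, smul_eq_mul]
  have h1 := Real.sin_sq_add_cos_sq φ
  have h2 := Real.sin_sq_add_cos_sq θ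
  linear_combination (B (b 0) (b 0) * Real.cos θ ^ 2 +
    (B (b 0) (b 1) + B (b 1) (b 0)) * (Real.cos θ * Real.sin θ) + B (b 1) (b 1) * Real.sin θ ^ 2
    + B (b 2) (b 2)) * h1 + (B (b 0) (b 0) + B (b 1) (b 1)) * h2

theorem Smooth.fderiv {u : Fn} (hu : Smooth u) :
    ContDiff ℝ 1 (_root_.fderiv ℝ fun p : ℝ × E3 => u p.1 p.2) :=
  (contDiff_infty_iff_fderiv.1 hu).2.of_le (by exact_mod_cast le_top)

theorem pt_eq_fderiv {u : Fn} (hu : Differentiable ℝ fun p : ℝ × E3 => u p.1 p.2)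
    (t : ℝ) (x : E3) :
    pt u t x = fderiv ℝ (fun p : ℝ × E3 => u p.1 p.2) (t, x) (1, 0) := by
  have h := (hu (t, x)).hasFDerivAt.comp_hasDerivAt t
    ((hasDerivAt_id t).prodMk (hasDerivAt_const t x))
  exact h.deriv

theorem pd_eq_fderiv {u : Fn} (hu : Differentiable ℝ fun p : ℝ × E3 => u p.1 p.2) (j : Fin 3)
    (t : ℝ) (x : E3) :
    pd j u t x =
      fderiv ℝ (fun p : ℝ × E3 => u p.1 p.2) (t, x) (0, EuclideanSpace.single j 1) := by
  have h := (hu (t, x)).hasFDerivAt.comp x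
    ((hasFDerivAt_const t x).prodMk (hasFDerivAt_id x))
  change fderiv ℝ ((fun p : ℝ × E3 => u p.1 p.2) ∘ Prod.mk t) x _ = _
  simp [h.fderiv]

theorem pt_pt_eq_fderiv {u : Fn} (hu : Smooth u) (t : ℝ) (x : E3) :
    pt (pt u) t x =
      fderiv ℝ (fderiv ℝ fun p : ℝ × E3 => u p.1 p.2) (t, x) (1, 0) (1, 0) := by
  have hL : Differentiable ℝ (fderiv ℝ fun p : ℝ × E3 => u p.1 p.2) :=
    hu.fderiv.differentiable one_ne_zero
  have h1 : pt u = fun t x => fderiv ℝ (fun p : ℝ × E3 => u p.1 p.2) (t, x) (1, 0) := by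
    ext t x; exact pt_eq_fderiv (hu.differentiable (by simp)) t x
  rw [h1, pt_eq_fderiv (u := fun t x => fderiv ℝ (fun p : ℝ × E3 => u p.1 p.2) (t, x) (1, 0))
    (by simpa using hL.clm_apply (differentiable_const _))]
  have := (hL (t, x)).hasFDerivAt.clm_apply (hasFDerivAt_const ((1, 0) : ℝ × E3) (t, x))
  simp [this.fderiv]

theorem pd_pd_eq_fderiv {u : Fn} (hu : Smooth u) (j : Fin 3) (t : ℝ) (x : E3) :
    pd j (pd j u) t x =
      fderiv ℝ (fderiv ℝ fun p : ℝ × E3 => u p.1 p.2) (t, x) (0, EuclideanSpace.single j 1)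
        (0, EuclideanSpace.single j 1) := by
  have hL : Differentiable ℝ (fderiv ℝ fun p : ℝ × E3 => u p.1 p.2) :=
    hu.fderiv.differentiable one_ne_zero
  have h1 : pd j u = fun t x => fderiv ℝ (fun p : ℝ × E3 => u p.1 p.2) (t, x)
      (0, EuclideanSpace.single j 1) := by
    ext t x; exact pd_eq_fderiv (hu.differentiable (by simp)) j t x
  rw [h1, pd_eq_fderiv (u := fun t x =>
    fderiv ℝ (fun p : ℝ × E3 => u p.1 p.2) (t, x) (0, EuclideanSpace.single j 1))
    (by simpa using hL.clm_apply (differentiable_const _))]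
  have := (hL (t, x)).hasFDerivAt.clm_apply (hasFDerivAt_const ((0, EuclideanSpace.single j 1) : ℝ × E3)
    (t, x))
  simp [this.fderiv]

/-- The wave equation in an arbitrary orthonormal frame, up to time zero. -/
theorem wave_eq_frame {c : ℝ} {G u : Fn} (hG : Smooth G) (hu : IsWaveSol c G u)
    {t : ℝ} (ht : 0 ≤ t) (x : E3) :
    fderiv ℝ (fderiv ℝ fun p : ℝ × E3 => u p.1 p.2) (t, x) (1, 0) (1, 0) -
      c ^ 2 * ∑ i, fderiv ℝ (fderiv ℝ fun p : ℝ × E3 => u p.1 p.2) (t, x) (0, b i) (0, b i) =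
        G t x := by
  obtain ⟨hs, heq, -, -⟩ := hu
  have hM : Continuous (fderiv ℝ (fderiv ℝ fun p : ℝ × E3 => u p.1 p.2)) :=
    hs.fderiv.continuous_fderiv one_ne_zero
  have hclosed : IsClosed {t : ℝ |
      fderiv ℝ (fderiv ℝ fun p : ℝ × E3 => u p.1 p.2) (t, x) (1, 0) (1, 0) -
      c ^ 2 * ∑ i, fderiv ℝ (fderiv ℝ fun p : ℝ × E3 => u p.1 p.2) (t, x) (0, b i) (0, b i) =
        G t x} := by
    apply isClosed_eq
    · fun_prop
    · exact hG.continuous.comp (by fun_prop : Continuous fun t : ℝ => (t, x))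
  have hsub : Ioi (0 : ℝ) ⊆ {t : ℝ |
      fderiv ℝ (fderiv ℝ fun p : ℝ × E3 => u p.1 p.2) (t, x) (1, 0) (1, 0) -
      c ^ 2 * ∑ i, fderiv ℝ (fderiv ℝ fun p : ℝ × E3 => u p.1 p.2) (t, x) (0, b i) (0, b i) =
        G t x} := by
    intro τ hτ
    have h := heq τ x hτ
    rw [pt_pt_eq_fderiv hs] at h
    simp only [pd_pd_eq_fderiv hs] at h
    let M := fderiv ℝ (fderiv ℝ fun p : ℝ × E3 => u p.1 p.2) (τ, x)
    let B : E3 →ₗ[ℝ] E3 →ₗ[ℝ] ℝ := LinearMap.mk₂ ℝ (fun v w => M (0, v) (0, w))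
      (fun v v' w => by
        rw [show ((0 : ℝ), v + v') = (0, v) + (0, v') by simp, map_add]; rfl)
      (fun a v w => by
        rw [show ((0 : ℝ), a • v) = a • (0, v) by simp, map_smul]; rfl)
      (fun v w w' => by
        rw [show ((0 : ℝ), w + w') = (0, w) + (0, w') by simp, map_add])
      (fun a v w => by
        rw [show ((0 : ℝ), a • w) = a • (0, w) by simp, map_smul])
    have hB := sum_bilin_orthonormalBasis b (EuclideanSpace.basisFun (Fin 3) ℝ) B
    simp only [B, LinearMap.mk₂_apply, EuclideanSpace.basisFun_apply, M] at hB
    rw [mem_ofPred_eq, hB, h]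
  have := closure_minimal hsub hclosed
  rw [closure_Ioi] at this
  exact this ht

/-- Kirchhoff's formula, in spherical coordinates, for vanishing initial data. -/
theorem kirchhoff {c : ℝ} {G u : Fn} (hG : Smooth G) (hu : IsWaveSol c G u) {t : ℝ} (ht : 0 ≤ t)
    (x : E3) :
    4 * Real.pi * c * u t x = ∫ s in (0 : ℝ)..t, ∫ φ in (0 : ℝ)..Real.pi,
      ∫ θ in (0 : ℝ)..2 * Real.pi,
        c * s * Real.sin φ * G (t - s) (x + (c * s) • sph b φ θ) := by
  set U : ℝ × E3 → ℝ := fun p => u p.1 p.2 with hU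
  have hs : ContDiff ℝ (⊤ : ℕ∞) U := hu.1
  have hLc : ContDiff ℝ 1 (fderiv ℝ U) := hu.1.fderiv
  set L := fderiv ℝ U with hLdef
  set M := fderiv ℝ L with hMdef
  have cU : Continuous U := hs.continuous
  have cL : Continuous L := hLc.continuous
  have cM : Continuous M := hLc.continuous_fderiv one_ne_zero
  have dU (p : ℝ × E3) : HasFDerivAt U (L p) p :=
    (hs.differentiable (by simp) p).hasFDerivAt
  have dL (p : ℝ × E3) : HasFDerivAt L (M p) p :=
    (hLc.differentiable one_ne_zero p).hasFDerivAt
  have cω := continuous_sph b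
  have cp := continuous_sphPolar b
  have ca := continuous_sphAzim b
  set pos : ℝ → ℝ → ℝ → ℝ × E3 := fun s φ θ => (t - s, x + (c * s) • sph b φ θ) with hpos
  have cpos : Continuous fun p : ℝ × ℝ × ℝ => pos p.1 p.2.1 p.2.2 := by
    simp only [hpos]; fun_prop
  have dpos_s (s φ θ : ℝ) : HasDerivAt (fun s => pos s φ θ) (-1, c • sph b φ θ) s := by
    refine HasDerivAt.prodMk ((hasDerivAt_id s).const_sub t) ?_
    simpa using (((hasDerivAt_id s).const_mul c).smul_const (sph b φ θ)).const_add x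
  have dpos_φ (s φ θ : ℝ) :
      HasDerivAt (fun φ => pos s φ θ) (0, (c * s) • sphPolar b φ θ) φ :=
    (hasDerivAt_const φ (t - s)).prodMk
      (((hasDerivAt_sph_polar b φ θ).const_smul (c * s)).const_add x)
  have dpos_θ (s φ θ : ℝ) :
      HasDerivAt (fun θ => pos s φ θ) (0, (c * s) • Real.sin φ • sphAzim b θ) θ :=
    (hasDerivAt_const θ (t - s)).prodMk
      (((hasDerivAt_sph_azim b φ θ).const_smul (c * s)).const_add x)
  have dLv {g : ℝ → ℝ × E3} {g' : ℝ × E3} {v : ℝ → ℝ × E3} {v' : ℝ × E3} {z : ℝ}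
      (hg : HasDerivAt g g' z) (hv : HasDerivAt v v' z) :
      HasDerivAt (fun z => L (g z) (v z)) (M (g z) g' (v z) + L (g z) v') z :=
    ((dL (g z)).comp_hasDerivAt z hg).clm_apply hv
  let P : ℝ → ℝ → ℝ → ℝ := fun s φ θ =>
    Real.sin φ * (c * s * L (pos s φ θ) (1, c • sph b φ θ) + c * U (pos s φ θ))
  let P' : ℝ → ℝ → ℝ → ℝ := fun s φ θ =>
    Real.sin φ * (c * L (pos s φ θ) (1, c • sph b φ θ) +
      c * s * M (pos s φ θ) (-1, c • sph b φ θ) (1, c • sph b φ θ) +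
      c * L (pos s φ θ) (-1, c • sph b φ θ))
  let Q : ℝ → ℝ → ℝ → ℝ := fun s φ θ =>
    c ^ 2 * (Real.sin φ * L (pos s φ θ) (0, sphPolar b φ θ))
  let Q' : ℝ → ℝ → ℝ → ℝ := fun s φ θ =>
    c ^ 2 * (Real.cos φ * L (pos s φ θ) (0, sphPolar b φ θ) +
      Real.sin φ * (M (pos s φ θ) (0, (c * s) • sphPolar b φ θ) (0, sphPolar b φ θ) +
        L (pos s φ θ) (0, -sph b φ θ)))
  let R : ℝ → ℝ → ℝ → ℝ := fun s φ θ => c ^ 2 * L (pos s φ θ) (0, sphAzim b θ)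
  let R' : ℝ → ℝ → ℝ → ℝ := fun s φ θ =>
    c ^ 2 * (M (pos s φ θ) (0, (c * s) • Real.sin φ • sphAzim b θ) (0, sphAzim b θ) +
        L (pos s φ θ) (0, -(Real.sin φ • sph b φ θ + Real.cos φ • sphPolar b φ θ)))
  have hP (s φ θ : ℝ) : HasDerivAt (fun s => P s φ θ) (P' s φ θ) s := by
    have h1 := dLv (dpos_s s φ θ) (hasDerivAt_const s (1, c • sph b φ θ))
    have h2 := (dU (pos s φ θ)).comp_hasDerivAt s (dpos_s s φ θ)
    have h3 := (((((hasDerivAt_id s).const_mul c).mul h1).add (h2.const_mul c)).const_mul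
      (Real.sin φ))
    convert! h3 using 1
    simp [P']
  have hQ (s φ θ : ℝ) : HasDerivAt (fun φ => Q s φ θ) (Q' s φ θ) φ :=
    (((Real.hasDerivAt_sin φ).mul (dLv (dpos_φ s φ θ)
      ((hasDerivAt_const φ (0 : ℝ)).prodMk (hasDerivAt_sphPolar b φ θ)))).const_mul (c ^ 2))
  have hR (s φ θ : ℝ) : HasDerivAt (fun θ => R s φ θ) (R' s φ θ) θ :=
    (dLv (dpos_θ s φ θ)
      ((hasDerivAt_const θ (0 : ℝ)).prodMk (hasDerivAt_sphAzim b φ θ))).const_mul (c ^ 2)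
  have cP : Continuous fun p : ℝ × ℝ × ℝ => P' p.1 p.2.1 p.2.2 := by
    simp only [P']; fun_prop
  have cQ : Continuous fun p : ℝ × ℝ × ℝ => Q' p.1 p.2.1 p.2.2 := by
    simp only [Q']; fun_prop
  have cR : Continuous fun p : ℝ × ℝ × ℝ => R' p.1 p.2.1 p.2.2 := by
    simp only [R']; fun_prop
  have key := integral_divergence_box (T := t) (a := Real.pi) (b := 2 * Real.pi) hP hQ hR cP cQ cR
    (by intro s θ; simp [Q]) (by intro s φ; simp [R, hpos, sph, sphAzim])
  have hsum (s φ θ : ℝ) (hst : s ≤ t) : P' s φ θ + Q' s φ θ + R' s φ θ =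
      -(c * s * Real.sin φ * G (t - s) (x + (c * s) • sph b φ θ)) := by
    rw [← wave_eq_frame b hG hu (sub_nonneg.2 hst)]
    have hpp : (t - s, x + (c * s) • sph b φ θ) = pos s φ θ := rfl
    rw [hpp, ← hU, ← hLdef, ← hMdef]
    set p := pos s φ θ
    have e1 (a : ℝ) (v : E3) : ((a, v) : ℝ × E3) = a • (1, 0) + (0, v) := by simp
    have e2 (a : ℝ) (v : E3) : ((0, a • v) : ℝ × E3) = a • (0, v) := by simp
    have e3 (v w : E3) : ((0, v + w) : ℝ × E3) = (0, v) + (0, w) := by simp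
    have e4 (v : E3) : ((0, -v) : ℝ × E3) = -(0, v) := by simp
    have hsymm (v w : ℝ × E3) : M p v w = M p w v :=
      second_derivative_symmetric (f := U) dU (dL p) v w
    let B : E3 →ₗ[ℝ] E3 →ₗ[ℝ] ℝ := LinearMap.mk₂ ℝ (fun v w => M p (0, v) (0, w))
      (fun v v' w => by rw [e3, map_add]; rfl)
      (fun a v w => by rw [e2, map_smul]; rfl)
      (fun v w w' => by rw [e3, map_add])
      (fun a v w => by rw [e2, map_smul])
    have hB := bilin_sph_frame b B φ θ
    simp only [B, LinearMap.mk₂_apply] at hB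
    rw [← hB]
    simp only [P', Q', R']
    rw [e1 1, e1 (-1)]
    simp only [e2, e3, e4, map_add, map_smul, map_neg, add_apply,
      smul_apply, smul_eq_mul]
    rw [hsymm (1, 0) (0, sph b φ θ)]
    ring
  have hint : ∫ s in (0 : ℝ)..t, ∫ φ in (0 : ℝ)..Real.pi, ∫ θ in (0 : ℝ)..2 * Real.pi,
      (P' s φ θ + Q' s φ θ + R' s φ θ) = -∫ s in (0 : ℝ)..t, ∫ φ in (0 : ℝ)..Real.pi,
      ∫ θ in (0 : ℝ)..2 * Real.pi,
        c * s * Real.sin φ * G (t - s) (x + (c * s) • sph b φ θ) := by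
    rw [← intervalIntegral.integral_neg]
    refine integral_congr fun s hs => ?_
    rw [uIcc_of_le ht] at hs
    simp only [← intervalIntegral.integral_neg, hsum _ _ _ hs.2]
  have hPT (φ θ : ℝ) : P t φ θ - P 0 φ θ = -(Real.sin φ * (c * u t x)) := by
    have hz (y : E3) : L (0, y) = 0 := by
      have h1 : L (0, y) (1, 0) = 0 := by
        exact (pt_eq_fderiv (hs.differentiable (by simp)) 0 y).symm.trans (hu.2.2.2 y)
      have h2 (v : E3) : L (0, y) (0, v) = 0 := by
        have h := (dU (0, y)).comp y ((hasFDerivAt_const (0 : ℝ) y).prodMk (hasFDerivAt_id y))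
        have h0 : (U ∘ Prod.mk (0 : ℝ)) = fun _ => 0 := by
          ext y; exact hu.2.2.1 y
        rw [h0] at h
        have := congrArg (fun f : E3 →L[ℝ] ℝ => f v) (h.unique (hasFDerivAt_const 0 y))
        simpa using this
      ext v
      · simpa using h1
      · simpa using h2 _
    have hu0 (y : E3) : U (0, y) = 0 := hu.2.2.1 y
    simp only [P, hpos, sub_self, hz, hu0]
    simp [hU]
  rw [hint] at key
  simp only [hPT] at key
  have : ∫ φ in (0 : ℝ)..Real.pi, ∫ _θ in (0 : ℝ)..2 * Real.pi, -(Real.sin φ * (c * u t x)) =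
      -(4 * Real.pi * c * u t x) := by
    simp only [intervalIntegral.integral_const, smul_eq_mul, intervalIntegral.integral_const_mul,
      intervalIntegral.integral_neg, intervalIntegral.integral_mul_const, integral_sin]
    simp
    ring
  rw [this] at key
  linarith

theorem jb_pos (a : ℝ) : 0 < jb a := Real.sqrt_pos.2 (by positivity)

theorem one_le_jb (a : ℝ) : 1 ≤ jb a := Real.one_le_sqrt.2 (by nlinarith [sq_nonneg a])

theorem abs_le_jb (a : ℝ) : |a| ≤ jb a := Real.abs_le_sqrt (by linarith)

theorem jb_le_one_add_abs (a : ℝ) : jb a ≤ 1 + |a| :=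
  Real.sqrt_le_iff.2 ⟨by positivity, by nlinarith [abs_nonneg a, sq_abs a]⟩

theorem one_add_abs_le_two_mul_jb (a : ℝ) : 1 + |a| ≤ 2 * jb a := by
  linarith [one_le_jb a, abs_le_jb a]

theorem jb_le_jb {a a' : ℝ} (h : |a| ≤ |a'|) : jb a ≤ jb a' :=
  Real.sqrt_le_sqrt (by linarith [sq_le_sq.2 h])

theorem jb_mul_le {m : ℝ} (hm : 1 ≤ m) (a : ℝ) : jb (m * a) ≤ m * jb a := by
  refine Real.sqrt_le_iff.2 ⟨mul_nonneg (by linarith) (jb_pos a).le, ?_⟩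
  rw [mul_pow m (jb a), jb, Real.sq_sqrt (by positivity)]
  nlinarith

theorem continuous_jb : Continuous jb := by unfold jb; fun_prop

theorem continuous_jb_rpow (p : ℝ) : Continuous fun a => jb a ^ p :=
  continuous_jb.rpow_const fun a => Or.inl (jb_pos a).ne'

theorem integrable_jb_rpow {μ : ℝ} (hμ : 0 < μ) : Integrable fun z : ℝ => jb z ^ (-(1 + μ)) := by
  have h := integrable_rpow_neg_one_add_norm_sq (E := ℝ) (μ := volume) (r := 1 + μ) (by simpa)
  refine h.congr (Filter.Eventually.of_forall fun z => ?_)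
  simp only [jb, Real.sqrt_eq_rpow, Real.norm_eq_abs, sq_abs]
  rw [← Real.rpow_mul (by positivity)]
  congr 1
  ring

variable {N : ℕ} (cs : Fin N → ℝ)

theorem wgt_pos (τ r : ℝ) : 0 < wgt cs τ r := by
  simp [wgt, Finset.lt_inf'_iff, jb_pos]

theorem exists_wgt_eq (τ r : ℝ) : ∃ j, wgt cs τ r = jb (cs0 cs j * τ - r) := by
  obtain ⟨j, -, hj⟩ := Finset.exists_mem_eq_inf' (Finset.univ_nonempty (α := Fin (N + 1)))
    fun j => jb (cs0 cs j * τ - r)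
  exact ⟨j, hj⟩

theorem continuous_wgt : Continuous fun p : ℝ × ℝ => wgt cs p.1 p.2 := by
  unfold wgt
  refine Continuous.finset_inf'_apply _ fun j _ => ?_
  exact continuous_jb.comp (by fun_prop)

theorem cs0_nonneg (hcs : ∀ j, 0 < cs j) (j : Fin (N + 1)) : 0 ≤ cs0 cs j := by
  refine Fin.cases ?_ (fun i => ?_) j
  · simp [cs0]
  · simpa [cs0] using (hcs i).le

theorem vnorm_zero (f : Fn) (t : ℝ) (x : E3) : vnorm 0 f t x = |f t x| := by
  have h : multiIdx 0 = {0} := by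
    ext α
    simp [multiIdx, funext_iff]
  simp [vnorm, h, Zpow]

theorem bddAbove_cone {G : Fn} (hG : Smooth G) (c κ μ t : ℝ) (hc : 0 < c) (x : E3) :
    BddAbove {a : ℝ | ∃ τ : ℝ, ∃ y : E3, 0 ≤ τ ∧ τ ≤ t ∧ ‖y - x‖ ≤ c * (t - τ) ∧
      a = ‖y‖ * jb (τ + ‖y‖) ^ κ * wgt cs τ ‖y‖ ^ (1 + μ) * vnorm 0 G τ y} := by
  have hcont : Continuous fun p : ℝ × E3 =>
      ‖p.2‖ * jb (p.1 + ‖p.2‖) ^ κ * wgt cs p.1 ‖p.2‖ ^ (1 + μ) * vnorm 0 G p.1 p.2 := by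
    simp only [vnorm_zero]
    have h1 : Continuous fun p : ℝ × E3 => jb (p.1 + ‖p.2‖) ^ κ :=
      (continuous_jb_rpow κ).comp (by fun_prop)
    have h2 : Continuous fun p : ℝ × E3 => wgt cs p.1 ‖p.2‖ ^ (1 + μ) :=
      ((continuous_wgt cs).comp (by fun_prop : Continuous fun p : ℝ × E3 => (p.1, ‖p.2‖))).rpow_const
        fun p => Or.inl (wgt_pos cs _ _).ne'
    have h3 : Continuous fun p : ℝ × E3 => G p.1 p.2 := hG.continuous
    fun_prop
  refine (((isCompact_Icc (a := (0 : ℝ)) (b := t)).prod (isCompact_closedBall x (c * t))).bddAbove_image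
    hcont.continuousOn).mono ?_
  rintro a ⟨τ, y, h0, hτ, hy, rfl⟩
  refine ⟨(τ, y), ⟨⟨h0, hτ⟩, ?_⟩, rfl⟩
  rw [mem_closedBall_iff_norm]
  nlinarith

theorem Afun_nonneg {G : Fn} (c κ μ t : ℝ) (x : E3) :
    0 ≤ Afun κ μ 0 G c cs t x := by
  refine Real.sSup_nonneg ?_
  rintro a ⟨τ, y, -, -, -, rfl⟩
  rw [vnorm_zero]
  have h1 := jb_pos (τ + ‖y‖)
  have h2 := wgt_pos cs τ ‖y‖
  positivity

/-- The radial majorant in the variables `τ` and `ξ = c τ + |y|`. -/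
def kerBound (c κ μ : ℝ) {N : ℕ} (cs : Fin N → ℝ) (τ ξ : ℝ) : ℝ :=
  jb ξ ^ (-κ) * ∑ j, jb ((cs0 cs j + c) * τ - ξ) ^ (-(1 + μ))

theorem kerBound_nonneg (c κ μ τ ξ : ℝ) : 0 ≤ kerBound c κ μ cs τ ξ :=
  mul_nonneg (Real.rpow_nonneg (jb_pos _).le _)
    (Finset.sum_nonneg fun _ _ => Real.rpow_nonneg (jb_pos _).le _)

theorem continuous_kerBound (c κ μ : ℝ) :
    Continuous fun p : ℝ × ℝ => kerBound c κ μ cs p.1 p.2 := by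
  unfold kerBound
  refine ((continuous_jb_rpow _).comp continuous_snd).mul (continuous_finsetSum _ fun j _ => ?_)
  exact (continuous_jb_rpow _).comp (by fun_prop)

theorem norm_mul_abs_le_kerBound {G : Fn} (hG : Smooth G) {c κ μ t : ℝ} (hc : 0 < c) (hκ : 0 ≤ κ)
    {x : E3} {τ : ℝ} {y : E3} (h0 : 0 ≤ τ) (hτ : τ ≤ t) (hy : ‖y - x‖ ≤ c * (t - τ)) :
    ‖y‖ * |G τ y| ≤
      max 1 c ^ κ * Afun κ μ 0 G c cs t x * kerBound c κ μ cs τ (c * τ + ‖y‖) := by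
  have hA : ‖y‖ * jb (τ + ‖y‖) ^ κ * wgt cs τ ‖y‖ ^ (1 + μ) * |G τ y| ≤
      Afun κ μ 0 G c cs t x := by
    refine le_csSup (bddAbove_cone cs hG c κ μ t hc x) ⟨τ, y, h0, hτ, hy, ?_⟩
    rw [vnorm_zero]
  have hA0 := Afun_nonneg cs (G := G) c κ μ t x
  have hn := norm_nonneg y
  have hm : 1 ≤ max 1 c := le_max_left _ _
  have hj1 := jb_pos (τ + ‖y‖)
  have hj2 := jb_pos (c * τ + ‖y‖)
  have hw := wgt_pos cs τ ‖y‖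
  have h1 : (jb (τ + ‖y‖) ^ κ)⁻¹ ≤ max 1 c ^ κ * jb (c * τ + ‖y‖) ^ (-κ) := by
    have hle : jb (c * τ + ‖y‖) ≤ max 1 c * jb (τ + ‖y‖) := by
      refine (jb_le_jb ?_).trans (jb_mul_le hm _)
      rw [abs_of_nonneg (by positivity), abs_of_nonneg (by positivity)]
      nlinarith [le_max_right 1 c]
    have := Real.rpow_le_rpow hj2.le hle hκ
    rw [Real.mul_rpow (by positivity) hj1.le] at this
    rw [Real.rpow_neg hj2.le, ← div_eq_mul_inv, inv_eq_one_div, div_le_div_iff₀ (by positivity)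
      (by positivity)]
    linarith
  have h2 : (wgt cs τ ‖y‖ ^ (1 + μ))⁻¹ ≤
      ∑ j, jb ((cs0 cs j + c) * τ - (c * τ + ‖y‖)) ^ (-(1 + μ)) := by
    obtain ⟨j, hj⟩ := exists_wgt_eq cs τ ‖y‖
    rw [hj, ← Real.rpow_neg (jb_pos _).le]
    refine le_trans (le_of_eq ?_) (Finset.single_le_sum
      (f := fun j => jb ((cs0 cs j + c) * τ - (c * τ + ‖y‖)) ^ (-(1 + μ)))
      (fun j _ => Real.rpow_nonneg (jb_pos _).le _) (Finset.mem_univ j))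
    ring_nf
  calc ‖y‖ * |G τ y|
      = ‖y‖ * jb (τ + ‖y‖) ^ κ * wgt cs τ ‖y‖ ^ (1 + μ) * |G τ y| *
          ((jb (τ + ‖y‖) ^ κ)⁻¹ * (wgt cs τ ‖y‖ ^ (1 + μ))⁻¹) := by
        field_simp
    _ ≤ Afun κ μ 0 G c cs t x * (max 1 c ^ κ * jb (c * τ + ‖y‖) ^ (-κ) *
          ∑ j, jb ((cs0 cs j + c) * τ - (c * τ + ‖y‖)) ^ (-(1 + μ))) := by
        gcongr
    _ = _ := by
        unfold kerBound
        ring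

theorem integral_kerBound_le {c κ μ : ℝ} (hc : 0 < c) (hcs : ∀ j, 0 < cs j) (hμ : 0 < μ)
    {t : ℝ} (ht : 0 ≤ t) (ξ : ℝ) :
    ∫ s in (0 : ℝ)..t, kerBound c κ μ cs (t - s) ξ ≤
      ((N + 1) * (∫ z, jb z ^ (-(1 + μ))) / c) * jb ξ ^ (-κ) := by
  rw [intervalIntegral.integral_comp_sub_left (fun τ => kerBound c κ μ cs τ ξ) t]
  simp only [kerBound, sub_self, sub_zero]
  rw [intervalIntegral.integral_const_mul, intervalIntegral.integral_finsetSum]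
  swap
  · intro j _
    exact ((continuous_jb_rpow _).comp (by fun_prop)).intervalIntegrable _ _
  rw [mul_comm]
  refine mul_le_mul_of_nonneg_right ?_ (Real.rpow_nonneg (jb_pos _).le _)
  have hK : 0 ≤ ∫ z, jb z ^ (-(1 + μ)) :=
    integral_nonneg fun z => Real.rpow_nonneg (jb_pos _).le _
  have hj (j : Fin (N + 1)) : ∫ τ in (0 : ℝ)..t, jb ((cs0 cs j + c) * τ - ξ) ^ (-(1 + μ)) ≤
      (∫ z, jb z ^ (-(1 + μ))) / c := by
    have ha : c ≤ cs0 cs j + c := by linarith [cs0_nonneg cs hcs j]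
    rw [intervalIntegral.integral_comp_mul_sub (fun z => jb z ^ (-(1 + μ))) (by linarith),
      smul_eq_mul, div_eq_inv_mul]
    rw [intervalIntegral.integral_of_le (by nlinarith)]
    refine (mul_le_mul_of_nonneg_left (setIntegral_le_integral (integrable_jb_rpow hμ)
      (Filter.Eventually.of_forall fun z => Real.rpow_nonneg (jb_pos _).le _))
      (inv_nonneg.2 (hc.le.trans ha))).trans ?_
    gcongr
  calc _ ≤ ∑ _j : Fin (N + 1), (∫ z, jb z ^ (-(1 + μ))) / c := Finset.sum_le_sum fun j _ => hj j
    _ = _ := by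
      simp
      ring

/-- Integrating a radial function over a sphere of radius `ρ` whose center has distance `r`
to the origin. -/
theorem integral_sphere_le {H f : ℝ → ℝ} (hH : Continuous H) (hf : Continuous f) {r ρ : ℝ}
    (hr : 0 < r) (hρ : 0 ≤ ρ)
    (hle : ∀ φ ∈ Ioo 0 Real.pi, f φ * √(r ^ 2 + ρ ^ 2 + 2 * r * ρ * Real.cos φ) ≤
      ρ * Real.sin φ * H √(r ^ 2 + ρ ^ 2 + 2 * r * ρ * Real.cos φ)) :
    ∫ φ in (0 : ℝ)..Real.pi, f φ ≤ (∫ l in |r - ρ|..r + ρ, H l) / r := by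
  set q : ℝ → ℝ := fun φ => r ^ 2 + ρ ^ 2 + 2 * r * ρ * Real.cos φ with hq
  have hqpos : ∀ φ ∈ Ioo 0 Real.pi, 0 < q φ := by
    intro φ hφ
    have hcos : -1 < Real.cos φ := by
      rw [← Real.cos_pi]
      exact Real.cos_lt_cos_of_nonneg_of_le_pi hφ.1.le le_rfl hφ.2
    rcases hρ.eq_or_lt with rfl | hρ
    · simpa [hq] using pow_pos hr 2
    · have := mul_pos (mul_pos hr hρ) (by linarith : 0 < 1 + Real.cos φ)
      simp only [hq]
      nlinarith [sq_nonneg (r - ρ)]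
  have hder : ∀ φ ∈ Ioo 0 Real.pi, HasDerivWithinAt (fun φ => -(∫ l in (0 : ℝ)..√(q φ), H l) / r)
      (ρ * Real.sin φ * H √(q φ) / √(q φ)) (Ioi φ) φ := by
    intro φ hφ
    have h1 : HasDerivAt q (2 * r * ρ * -Real.sin φ) φ :=
      ((Real.hasDerivAt_cos φ).const_mul (2 * r * ρ)).const_add (r ^ 2 + ρ ^ 2)
    have h2 := h1.sqrt (hqpos φ hφ).ne'
    have h3 := (hH.integral_hasStrictDerivAt 0 √(q φ)).hasDerivAt.comp φ h2
    refine HasDerivAt.hasDerivWithinAt ?_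
    convert! (h3.neg.div_const r) using 1
    have := Real.sqrt_pos.2 (hqpos φ hφ)
    field_simp
  have hcont : Continuous fun φ => -(∫ l in (0 : ℝ)..√(q φ), H l) / r := by
    have : Continuous fun z => ∫ l in (0 : ℝ)..z, H l :=
      continuous_primitive (fun a b => hH.intervalIntegrable a b) 0
    have hqc : Continuous q := by simp only [hq]; fun_prop
    exact ((this.comp hqc.sqrt).neg).div_const r
  have key := integral_le_sub_of_hasDeriv_right_of_le Real.pi_pos.le hcont.continuousOn hder
    (φ := f) hf.continuousOn.integrableOn_Icc (fun φ hφ => by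
      rw [le_div_iff₀ (Real.sqrt_pos.2 (hqpos φ hφ))]; exact hle φ hφ)
  refine key.trans (le_of_eq ?_)
  have e1 : √(q 0) = r + ρ := by
    rw [show q 0 = (r + ρ) ^ 2 by simp [hq]; ring, Real.sqrt_sq (by positivity)]
  have e2 : √(q Real.pi) = |r - ρ| := by
    rw [show q Real.pi = (r - ρ) ^ 2 by simp [hq]; ring, Real.sqrt_sq_eq_abs]
  rw [e1, e2, ← integral_interval_sub_left (hH.intervalIntegrable 0 (r + ρ))
    (hH.intervalIntegrable 0 |r - ρ|)]
  ring

theorem exists_orthonormalBasis_axis (x : E3) :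
    ∃ b : OrthonormalBasis (Fin 3) ℝ E3, x = ‖x‖ • b 2 := by
  rcases eq_or_ne x 0 with rfl | hx
  · exact ⟨EuclideanSpace.basisFun (Fin 3) ℝ, by simp⟩
  · have hv : Orthonormal ℝ (({2} : Set (Fin 3)).domRestrict fun _ => ‖x‖⁻¹ • x) := by
      refine ⟨fun i => ?_, fun i j hij => ?_⟩
      · simp [norm_smul, hx]
      · exact absurd (Subsingleton.elim i j) hij
    obtain ⟨b, hb⟩ := hv.exists_orthonormalBasis_extension_of_card_eq (by simp)
    refine ⟨b, ?_⟩
    rw [hb 2 rfl, smul_smul, mul_inv_cancel₀ (norm_ne_zero_iff.2 hx), one_smul]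

theorem norm_sph (φ θ : ℝ) : ‖sph b φ θ‖ = 1 := by
  have h : ‖sph b φ θ‖ ^ 2 = 1 := by
    rw [← b.sum_sq_norm_inner_right]
    simp [sph, Fin.sum_univ_three, inner_add_right, inner_smul_right, b.inner_eq_ite]
    linear_combination Real.sin φ ^ 2 * Real.sin_sq_add_cos_sq θ + Real.sin_sq_add_cos_sq φ
  exact (sq_eq_sq₀ (norm_nonneg _) zero_le_one).1 (by rw [h, one_pow])

theorem norm_axis_add_smul_sph (r ρ φ θ : ℝ) :
    ‖r • b 2 + ρ • sph b φ θ‖ = √(r ^ 2 + ρ ^ 2 + 2 * r * ρ * Real.cos φ) := by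
  have h : inner ℝ (b 2) (sph b φ θ) = Real.cos φ := by
    simp [sph, inner_add_right, inner_smul_right, b.inner_eq_ite]
  rw [← Real.sqrt_sq (norm_nonneg (r • b 2 + ρ • sph b φ θ)), norm_add_sq_real, norm_smul,
    norm_smul, norm_sph, inner_smul_left, inner_smul_right, h, b.norm_eq_one]
  congr 1
  simp
  ring

theorem Phi_pos (ρ T r : ℝ) : 0 < Phi ρ T r := by
  unfold Phi
  have h1 := jb_pos (T - r)
  have h2 := jb_pos (T + r)
  split_ifs
  · refine Real.log_pos ?_
    have : 0 < jb (T + r) / jb (T - r) := by positivity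
    linarith
  · positivity

theorem jb_rpow_le_two_mul_Phi (κ T r : ℝ) :
    jb (T - r) ^ (1 - κ) ≤ 2 * Phi (κ - 1) T r := by
  unfold Phi
  have h1 := jb_pos (T - r)
  have h2 := jb_pos (T + r)
  split_ifs with h
  · have hq : 0 < jb (T + r) / jb (T - r) := by positivity
    have h3 : Real.log 2 ≤ Real.log (2 + jb (T + r) / jb (T - r)) :=
      Real.log_le_log (by norm_num) (by linarith)
    rw [show 1 - κ = 0 by linarith, Real.rpow_zero]
    linarith [Real.log_two_gt_d9]
  · rw [neg_sub]
    linarith [Real.rpow_pos_of_pos h1 (1 - κ)]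

theorem exists_integral_jb_rpow_le {κ : ℝ} (hκ : 1 ≤ κ) :
    ∃ C > 0, ∀ T r : ℝ, 0 ≤ T → 0 ≤ r →
      ∫ ξ in |T - r|..T + r, jb ξ ^ (-κ) ≤ C * Phi (κ - 1) T r := by
  have hcont : Continuous fun ξ => jb ξ ^ (-κ) := continuous_jb_rpow _
  have hpt : ∀ ξ : ℝ, 0 ≤ ξ → jb ξ ^ (-κ) ≤ 2 ^ κ * (1 + ξ) ^ (-κ) := by
    intro ξ hξ
    have h := one_add_abs_le_two_mul_jb ξ
    rw [abs_of_nonneg hξ] at h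
    have h' : (1 + ξ) / 2 ≤ jb ξ := by linarith
    refine (Real.rpow_le_rpow_of_nonpos (by positivity) h' (by linarith)).trans (le_of_eq ?_)
    rw [Real.div_rpow (by positivity) (by norm_num), Real.rpow_neg (by norm_num : (0 : ℝ) ≤ 2)]
    field_simp
  have hab : ∀ T r : ℝ, 0 ≤ T → 0 ≤ r → |T - r| ≤ T + r := fun T r hT hr =>
    abs_sub_le_iff.2 ⟨by linarith, by linarith⟩
  rcases hκ.eq_or_lt with rfl | hκ
  · refine ⟨4, by norm_num, fun T r hT hr => ?_⟩
    have ha := abs_nonneg (T - r)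
    have hder : ∀ ξ ∈ Ioo |T - r| (T + r),
        HasDerivWithinAt (fun ξ => 2 * Real.log (1 + ξ)) (2 * (1 / (1 + ξ))) (Ioi ξ) ξ := by
      intro ξ hξ
      have : 1 + ξ ≠ 0 := by linarith [hξ.1]
      exact ((((hasDerivAt_id ξ).const_add 1).log this).const_mul 2).hasDerivWithinAt
    have hc : ContinuousOn (fun ξ => 2 * Real.log (1 + ξ)) (Icc |T - r| (T + r)) := by
      refine continuousOn_const.mul (ContinuousOn.log (by fun_prop) fun ξ hξ => ?_)
      linarith [hξ.1]
    have key := integral_le_sub_of_hasDeriv_right_of_le (hab T r hT hr) hc hder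
      (φ := fun ξ => jb ξ ^ (-1 : ℝ)) hcont.continuousOn.integrableOn_Icc (fun ξ hξ => by
        refine (hpt ξ (by linarith [hξ.1])).trans (le_of_eq ?_)
        rw [Real.rpow_one, Real.rpow_neg_one, one_div])
    refine key.trans ?_
    have h1 := jb_pos (T - r)
    have h2 := jb_pos (T + r)
    have hq : 0 < jb (T + r) / jb (T - r) := by positivity
    rw [Phi, if_pos (by norm_num), ← mul_sub, ← Real.log_div (by linarith) (by linarith)]
    have h3 : (1 + (T + r)) / (1 + |T - r|) ≤ (2 + jb (T + r) / jb (T - r)) ^ 2 := by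
      have h4 := one_add_abs_le_two_mul_jb (T + r)
      rw [abs_of_nonneg (by linarith)] at h4
      have h5 := jb_le_one_add_abs (T - r)
      calc (1 + (T + r)) / (1 + |T - r|) ≤ (2 * jb (T + r)) / jb (T - r) := by gcongr
        _ = 2 * (jb (T + r) / jb (T - r)) := by ring
        _ ≤ _ := by nlinarith
    have h6 := Real.log_le_log (by positivity) h3
    rw [Real.log_pow] at h6
    push_cast at h6
    linarith
  · refine ⟨2 ^ κ / (κ - 1), div_pos (by positivity) (by linarith), fun T r hT hr => ?_⟩
    have ha := abs_nonneg (T - r)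
    have hder : ∀ ξ ∈ Ioo |T - r| (T + r),
        HasDerivWithinAt (fun ξ => -(2 ^ κ / (κ - 1)) * (1 + ξ) ^ (1 - κ))
          (2 ^ κ * (1 + ξ) ^ (-κ)) (Ioi ξ) ξ := by
      intro ξ hξ
      have : 1 + ξ ≠ 0 := by linarith [hξ.1]
      have hd := (((hasDerivAt_id ξ).const_add 1).rpow_const (p := 1 - κ)
        (Or.inl this)).const_mul (-(2 ^ κ / (κ - 1)))
      refine HasDerivAt.hasDerivWithinAt ?_
      convert! hd using 1
      have : κ - 1 ≠ 0 := by linarith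
      rw [show 1 - κ - 1 = -κ by ring, id]
      field_simp
      ring
    have hc : ContinuousOn (fun ξ => -(2 ^ κ / (κ - 1)) * (1 + ξ) ^ (1 - κ))
        (Icc |T - r| (T + r)) := by
      refine continuousOn_const.mul (ContinuousOn.rpow_const (by fun_prop) fun ξ hξ => ?_)
      left; linarith [hξ.1]
    have key := integral_le_sub_of_hasDeriv_right_of_le (hab T r hT hr) hc hder
      (φ := fun ξ => jb ξ ^ (-κ)) hcont.continuousOn.integrableOn_Icc
      (fun ξ hξ => hpt ξ (by linarith [hξ.1]))
    refine key.trans ?_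
    rw [Phi, if_neg (by linarith), neg_sub]
    have h1 : (1 + |T - r|) ^ (1 - κ) ≤ jb (T - r) ^ (1 - κ) :=
      Real.rpow_le_rpow_of_nonpos (jb_pos _) (jb_le_one_add_abs _) (by linarith)
    have h2 : 0 ≤ (1 + (T + r)) ^ (1 - κ) := by positivity
    have h3 : 0 < 2 ^ κ / (κ - 1) := div_pos (by positivity) (by linarith)
    nlinarith [mul_le_mul_of_nonneg_left h1 h3.le, mul_nonneg h3.le h2]

theorem exists_jb_mul_integral_le {κ : ℝ} (hκ : 1 ≤ κ) :
    ∃ C > 0, ∀ T r : ℝ, 0 ≤ T → 0 < r →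
      jb (T + r) * ((∫ ξ in |T - r|..T + r, jb ξ ^ (-κ)) / r) ≤ C * Phi (κ - 1) T r := by
  obtain ⟨C, hC, hint⟩ := exists_integral_jb_rpow_le hκ
  refine ⟨8 * C + 12, by positivity, fun T r hT hr => ?_⟩
  have hPhi := Phi_pos (κ - 1) T r
  have hb := jb_pos (T + r)
  have ha := jb_pos (T - r)
  rcases le_total (jb (T + r)) (8 * r) with h | h
  · calc jb (T + r) * ((∫ ξ in |T - r|..T + r, jb ξ ^ (-κ)) / r)
        = jb (T + r) / r * ∫ ξ in |T - r|..T + r, jb ξ ^ (-κ) := by ring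
      _ ≤ 8 * (C * Phi (κ - 1) T r) := by
        have h0 : jb (T + r) / r ≤ 8 := (div_le_iff₀ hr).2 h
        have := hint T r hT hr.le
        calc jb (T + r) / r * ∫ ξ in |T - r|..T + r, jb ξ ^ (-κ)
            ≤ jb (T + r) / r * (C * Phi (κ - 1) T r) := by gcongr
          _ ≤ _ := by gcongr
      _ ≤ _ := by nlinarith
  · have hsub : T + r - |T - r| ≤ 2 * r := by
      linarith [neg_abs_le (T - r), le_abs_self (T - r)]
    have hle : |T - r| ≤ T + r := abs_sub_le_iff.2 ⟨by linarith, by linarith⟩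
    have h1 : ∫ ξ in |T - r|..T + r, jb ξ ^ (-κ) ≤ 2 * r * jb (T - r) ^ (-κ) := by
      have := intervalIntegral.integral_mono_on (μ := volume) hle
        ((continuous_jb_rpow (-κ)).intervalIntegrable _ _)
        (intervalIntegrable_const (c := jb (T - r) ^ (-κ))) (fun ξ hξ =>
          Real.rpow_le_rpow_of_nonpos ha (jb_le_jb (hξ.1.trans (le_abs_self ξ))) (by linarith))
      rw [intervalIntegral.integral_const, smul_eq_mul] at this
      exact this.trans (by gcongr)
    have h2 : jb (T + r) ≤ 3 * jb (T - r) := by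
      have h3 := jb_le_one_add_abs (T + r)
      rw [abs_of_nonneg (by linarith)] at h3
      linarith [one_le_jb (T - r), abs_le_jb (T - r)]
    have hI : 0 ≤ (∫ ξ in |T - r|..T + r, jb ξ ^ (-κ)) / r :=
      div_nonneg (intervalIntegral.integral_nonneg hle fun _ _ =>
        Real.rpow_nonneg (jb_pos _).le _) hr.le
    calc jb (T + r) * ((∫ ξ in |T - r|..T + r, jb ξ ^ (-κ)) / r)
        ≤ 3 * jb (T - r) * (2 * r * jb (T - r) ^ (-κ) / r) := by gcongr
      _ = 6 * jb (T - r) ^ (1 - κ) := by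
        rw [sub_eq_add_neg 1 κ, Real.rpow_add ha, Real.rpow_one]
        field_simp
        norm_num
      _ ≤ 6 * (2 * Phi (κ - 1) T r) := by gcongr; exact jb_rpow_le_two_mul_Phi κ T r
      _ ≤ _ := by nlinarith

/-- The integral of `sin φ * G` over a parallel of the sphere of radius `c * s` around `x`. -/
def parallelIntegral (G : Fn) (c t : ℝ) (x : E3) (s φ : ℝ) : ℝ :=
  ∫ θ in (0 : ℝ)..2 * Real.pi, c * s * Real.sin φ * G (t - s) (x + (c * s) • sph b φ θ)

theorem continuous_parallelIntegral {G : Fn} (hG : Smooth G) (c t : ℝ) (x : E3) :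
    Continuous fun p : ℝ × ℝ => parallelIntegral b G c t x p.1 p.2 := by
  have h0 : Continuous fun q : (ℝ × ℝ) × ℝ =>
      (t - q.1.1, x + (c * q.1.1) • sph b q.1.2 q.2) := by
    unfold sph
    fun_prop
  have h2 : Continuous fun q : (ℝ × ℝ) × ℝ =>
      G (t - q.1.1) (x + (c * q.1.1) • sph b q.1.2 q.2) := hG.continuous.comp h0
  have h3 : Continuous fun q : (ℝ × ℝ) × ℝ =>
      c * q.1.1 * Real.sin q.1.2 * G (t - q.1.1) (x + (c * q.1.1) • sph b q.1.2 q.2) :=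
    Continuous.mul (by fun_prop) h2
  exact continuous_parametric_intervalIntegral_of_continuous' (f := fun (p : ℝ × ℝ) θ =>
    c * p.1 * Real.sin p.2 * G (t - p.1) (x + (c * p.1) • sph b p.2 θ)) h3 0 (2 * Real.pi)

theorem abs_integral_parallelIntegral_le {c : ℝ} (hc : 0 < c) {κ μ : ℝ} (hκ : 1 ≤ κ)
    {G : Fn} (hG : Smooth G) {t : ℝ} {x : E3} (hx : 0 < ‖x‖) (hb : x = ‖x‖ • b 2) {s : ℝ}
    (hs : s ∈ Icc 0 t) :
    |∫ φ in (0 : ℝ)..Real.pi, parallelIntegral b G c t x s φ| ≤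
      2 * Real.pi * (max 1 c ^ κ * Afun κ μ 0 G c cs t x) / ‖x‖ *
        ∫ ξ in |c * t - ‖x‖|..c * t + ‖x‖, kerBound c κ μ cs (t - s) ξ := by
  set r := ‖x‖ with hr
  set D := max 1 c ^ κ * Afun κ μ 0 G c cs t x with hD
  have hD0 : 0 ≤ D := mul_nonneg (by positivity) (Afun_nonneg cs c κ μ t x)
  have hker := continuous_kerBound cs c κ μ
  have hFc := continuous_parallelIntegral b hG c t x
  have hcs0 : 0 ≤ c * s := mul_nonneg hc.le hs.1
  have hkc : Continuous fun ξ => kerBound c κ μ cs (t - s) ξ :=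
    hker.comp (by fun_prop : Continuous fun ξ : ℝ => (t - s, ξ))
  have hFsc : Continuous fun φ => parallelIntegral b G c t x s φ :=
    hFc.comp (by fun_prop : Continuous fun φ : ℝ => (s, φ))
  have h1 : |∫ φ in (0 : ℝ)..Real.pi, parallelIntegral b G c t x s φ| ≤
      ∫ φ in (0 : ℝ)..Real.pi, |parallelIntegral b G c t x s φ| :=
    intervalIntegral.abs_integral_le_integral_abs Real.pi_pos.le
  have h2 := integral_sphere_le
    (H := fun l => 2 * Real.pi * D * kerBound c κ μ cs (t - s) (l + c * (t - s)))
    (f := fun φ => |parallelIntegral b G c t x s φ|) (r := r) (ρ := c * s)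
    (continuous_const.mul (hkc.comp (by fun_prop))) hFsc.abs hx hcs0 ?_
  · refine (h1.trans h2).trans ?_
    rw [intervalIntegral.integral_const_mul,
      intervalIntegral.integral_comp_add_right (fun ξ => kerBound c κ μ cs (t - s) ξ)]
    rw [mul_div_right_comm]
    refine mul_le_mul_of_nonneg_left ?_ (by positivity)
    refine intervalIntegral.integral_mono_interval ?_ ?_ ?_
      (Filter.Eventually.of_forall fun ξ => kerBound_nonneg cs c κ μ _ ξ)
      (hkc.intervalIntegrable _ _)
    · have h4 : 0 ≤ c * (t - s) := mul_nonneg hc.le (by linarith [hs.2])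
      have h3 := abs_add_le (c * s - r) (c * (t - s))
      rw [abs_of_nonneg h4, show c * s - r + c * (t - s) = c * t - r by ring] at h3
      rw [abs_sub_comm r]
      linarith
    · have : |r - c * s| ≤ r + c * s := abs_sub_le_iff.2 ⟨by linarith, by linarith⟩
      linarith
    · linarith
  · intro φ hφ
    have hsin : 0 ≤ Real.sin φ := Real.sin_nonneg_of_nonneg_of_le_pi hφ.1.le hφ.2.le
    rw [← norm_axis_add_smul_sph b r (c * s) φ 0, ← hb]
    set l := ‖x + (c * s) • sph b φ 0‖ with hl
    have hnorm (θ : ℝ) : ‖x + (c * s) • sph b φ θ‖ = l := by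
      rw [hl, hb, norm_axis_add_smul_sph, norm_axis_add_smul_sph]
    have hpt : ∀ θ ∈ uIoc (0 : ℝ) (2 * Real.pi),
        ‖l * (c * s * Real.sin φ * G (t - s) (x + (c * s) • sph b φ θ))‖ ≤
          c * s * Real.sin φ * (D * kerBound c κ μ cs (t - s) (l + c * (t - s))) := by
      intro θ _
      have h3 := norm_mul_abs_le_kerBound cs hG (κ := κ) (μ := μ) hc (by linarith) (x := x)
        (τ := t - s) (t := t) (y := x + (c * s) • sph b φ θ) (by linarith [hs.2])
        (by linarith [hs.1])
        (by simp [norm_smul, norm_sph, abs_of_nonneg hc.le, abs_of_nonneg hs.1])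
      rw [hnorm, add_comm (c * (t - s))] at h3
      rw [Real.norm_eq_abs, abs_mul, abs_mul, abs_of_nonneg (by positivity : 0 ≤ l),
        abs_of_nonneg (by positivity : 0 ≤ c * s * Real.sin φ)]
      calc _ = c * s * Real.sin φ * (l * |G (t - s) (x + (c * s) • sph b φ θ)|) := by ring
        _ ≤ _ := by gcongr
    have h4 := intervalIntegral.norm_integral_le_of_norm_le_const hpt
    rw [intervalIntegral.integral_const_mul, Real.norm_eq_abs, abs_mul,
      abs_of_nonneg (by positivity : 0 ≤ l), sub_zero, abs_of_pos Real.two_pi_pos] at h4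
    change |parallelIntegral b G c t x s φ| * l ≤ _
    calc |parallelIntegral b G c t x s φ| * l = l * |parallelIntegral b G c t x s φ| := mul_comm _ _
      _ ≤ _ := h4
      _ = _ := by ring

/-- The solution is controlled by the integral of the majorant over the backward cone. -/
theorem abs_le_of_pos_norm {c : ℝ} (hc : 0 < c) (hcs : ∀ j, 0 < cs j) {κ μ : ℝ} (hκ : 1 ≤ κ)
    (hμ : 0 < μ) {G u : Fn} (hG : Smooth G) (hu : IsWaveSol c G u) {t : ℝ} (ht : 0 ≤ t)
    {x : E3} (hx : 0 < ‖x‖) :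
    2 * c * |u t x| ≤ max 1 c ^ κ * Afun κ μ 0 G c cs t x *
      ((N + 1) * (∫ z, jb z ^ (-(1 + μ))) / c) *
      ((∫ ξ in |c * t - ‖x‖|..c * t + ‖x‖, jb ξ ^ (-κ)) / ‖x‖) := by
  obtain ⟨b, hb⟩ := exists_orthonormalBasis_axis x
  set r := ‖x‖ with hr
  set D := max 1 c ^ κ * Afun κ μ 0 G c cs t x with hD
  have hD0 : 0 ≤ D := mul_nonneg (by positivity) (Afun_nonneg cs c κ μ t x)
  have hkir := kirchhoff b hG hu ht x
  have hker := continuous_kerBound cs c κ μ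
  have hFc := continuous_parallelIntegral b hG c t x
  have hF1 : Continuous fun s => ∫ φ in (0 : ℝ)..Real.pi, parallelIntegral b G c t x s φ :=
    continuous_parametric_intervalIntegral_of_continuous' (f := parallelIntegral b G c t x)
      hFc 0 Real.pi
  have hk2 : Continuous fun p : ℝ × ℝ => kerBound c κ μ cs (t - p.1) p.2 :=
    hker.comp (by fun_prop : Continuous fun p : ℝ × ℝ => (t - p.1, p.2))
  have hk3 : Continuous fun s => ∫ ξ in |c * t - r|..c * t + r, kerBound c κ μ cs (t - s) ξ :=
    continuous_parametric_intervalIntegral_of_continuous'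
      (f := fun s ξ => kerBound c κ μ cs (t - s) ξ) hk2 _ _
  have hk4 : Continuous fun ξ => ∫ s in (0 : ℝ)..t, kerBound c κ μ cs (t - s) ξ :=
    continuous_parametric_intervalIntegral_of_continuous'
      (f := fun ξ s => kerBound c κ μ cs (t - s) ξ)
      (hk2.comp (by fun_prop : Continuous fun p : ℝ × ℝ => (p.2, p.1))) _ _
  have hle : |c * t - r| ≤ c * t + r := by
    have : 0 ≤ c * t := by positivity
    exact abs_sub_le_iff.2 ⟨by linarith, by linarith⟩
  have hmain : 4 * Real.pi * c * |u t x| ≤ 2 * Real.pi * D / r *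
      (((N + 1) * (∫ z, jb z ^ (-(1 + μ))) / c) *
        ∫ ξ in |c * t - r|..c * t + r, jb ξ ^ (-κ)) := by
    calc 4 * Real.pi * c * |u t x| = |4 * Real.pi * c * u t x| := by
          rw [abs_mul, abs_of_nonneg (by positivity : 0 ≤ 4 * Real.pi * c)]
      _ ≤ ∫ s in (0 : ℝ)..t, |∫ φ in (0 : ℝ)..Real.pi, parallelIntegral b G c t x s φ| := by
          rw [hkir]; exact intervalIntegral.abs_integral_le_integral_abs ht
      _ ≤ ∫ s in (0 : ℝ)..t, 2 * Real.pi * D / r *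
            ∫ ξ in |c * t - r|..c * t + r, kerBound c κ μ cs (t - s) ξ :=
          intervalIntegral.integral_mono_on ht (hF1.abs.intervalIntegrable _ _)
            ((continuous_const.mul hk3).intervalIntegrable _ _)
            fun s hs => abs_integral_parallelIntegral_le b cs hc hκ hG hx hb hs
      _ = 2 * Real.pi * D / r * ∫ ξ in |c * t - r|..c * t + r,
            ∫ s in (0 : ℝ)..t, kerBound c κ μ cs (t - s) ξ := by
          rw [intervalIntegral.integral_const_mul, integral_integral_swap_of_continuous hk2]
      _ ≤ 2 * Real.pi * D / r * ∫ ξ in |c * t - r|..c * t + r,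
            ((N + 1) * (∫ z, jb z ^ (-(1 + μ))) / c) * jb ξ ^ (-κ) := by
          refine mul_le_mul_of_nonneg_left ?_ (by positivity)
          exact intervalIntegral.integral_mono_on hle (hk4.intervalIntegrable _ _)
            ((continuous_const.mul (continuous_jb_rpow _)).intervalIntegrable _ _)
            fun ξ _ => integral_kerBound_le cs hc hcs hμ ht ξ
      _ = _ := by rw [intervalIntegral.integral_const_mul]
  have hpi := Real.pi_pos
  refine le_of_mul_le_mul_left (le_trans (le_of_eq ?_) (hmain.trans (le_of_eq ?_)))
    (by positivity : 0 < 2 * Real.pi)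
  · ring
  · ring

theorem abs_le_at_origin {c : ℝ} (hc : 0 < c) (hcs : ∀ j, 0 < cs j) {κ μ : ℝ} (hκ : 1 ≤ κ)
    (hμ : 0 < μ) {G u : Fn} (hG : Smooth G) (hu : IsWaveSol c G u) {t : ℝ} (ht : 0 ≤ t) :
    2 * c * |u t 0| ≤ Real.pi * (max 1 c ^ κ * Afun κ μ 0 G c cs t 0 *
      ((N + 1) * (∫ z, jb z ^ (-(1 + μ))) / c) * jb (c * t) ^ (-κ)) := by
  let b := EuclideanSpace.basisFun (Fin 3) ℝ
  set D := max 1 c ^ κ * Afun κ μ 0 G c cs t 0 with hD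
  have hD0 : 0 ≤ D := mul_nonneg (by positivity) (Afun_nonneg cs c κ μ t 0)
  have hpi := Real.pi_pos
  have hpt (s : ℝ) (hs : s ∈ Ioc 0 t) : ‖∫ φ in (0 : ℝ)..Real.pi, ∫ θ in (0 : ℝ)..2 * Real.pi,
      c * s * Real.sin φ * G (t - s) (0 + (c * s) • sph b φ θ)‖ ≤
      2 * Real.pi ^ 2 * D * kerBound c κ μ cs (t - s) (c * t) := by
    have h (φ θ : ℝ) : ‖c * s * Real.sin φ * G (t - s) (0 + (c * s) • sph b φ θ)‖ ≤
        D * kerBound c κ μ cs (t - s) (c * t) := by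
      have hn : ‖(0 : E3) + (c * s) • sph b φ θ‖ = c * s := by
        simp [norm_smul, norm_sph, abs_of_nonneg hc.le, abs_of_nonneg hs.1.le]
      have h3 := norm_mul_abs_le_kerBound cs hG (κ := κ) (μ := μ) hc (by linarith) (x := 0)
          (τ := t - s) (t := t) (y := 0 + (c * s) • sph b φ θ) (by linarith [hs.2])
          (by linarith [hs.1]) (by rw [sub_zero, hn]; linarith)
      rw [hn, show c * (t - s) + c * s = c * t by ring] at h3
      rw [Real.norm_eq_abs, abs_mul, abs_mul, abs_of_nonneg (mul_nonneg hc.le hs.1.le)]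
      refine le_trans ?_ h3
      have := mul_nonneg hc.le hs.1.le
      calc c * s * |Real.sin φ| * |G (t - s) (0 + (c * s) • sph b φ θ)|
          ≤ c * s * 1 * |G (t - s) (0 + (c * s) • sph b φ θ)| := by
            gcongr; exact Real.abs_sin_le_one φ
        _ = _ := by ring
    have h4 := intervalIntegral.norm_integral_le_of_norm_le_const (a := 0) (b := Real.pi)
      (f := fun φ => ∫ θ in (0 : ℝ)..2 * Real.pi,
        c * s * Real.sin φ * G (t - s) (0 + (c * s) • sph b φ θ))
      fun φ _ => intervalIntegral.norm_integral_le_of_norm_le_const (a := 0) (b := 2 * Real.pi)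
        fun θ _ => h φ θ
    rw [sub_zero, sub_zero, abs_of_pos hpi, abs_of_pos Real.two_pi_pos] at h4
    exact h4.trans (le_of_eq (by ring))
  have hkc : Continuous fun s => 2 * Real.pi ^ 2 * D * kerBound c κ μ cs (t - s) (c * t) :=
    continuous_const.mul ((continuous_kerBound cs c κ μ).comp
      (by fun_prop : Continuous fun s : ℝ => (t - s, c * t)))
  have h := intervalIntegral.norm_integral_le_of_norm_le ht
    (Filter.Eventually.of_forall hpt) (hkc.intervalIntegrable (μ := volume) 0 t)
  rw [← kirchhoff b hG hu ht 0, intervalIntegral.integral_const_mul, Real.norm_eq_abs, abs_mul,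
    abs_of_nonneg (by positivity : 0 ≤ 4 * Real.pi * c)] at h
  have h2 := h.trans (mul_le_mul_of_nonneg_left
    (integral_kerBound_le cs (κ := κ) hc hcs hμ ht (c * t)) (by positivity))
  refine le_of_mul_le_mul_left (le_trans (le_of_eq ?_) (h2.trans (le_of_eq ?_)))
    (by positivity : 0 < 2 * Real.pi)
  · ring
  · ring

end

theorem stmt4 (c : ℝ) (hc : 0 < c) {N : ℕ} (cs : Fin N → ℝ) (hcs : ∀ j, 0 < cs j)
    (κ μ : ℝ) (hκ : 1 ≤ κ) (hμ : 0 < μ) :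
    ∃ C > (0 : ℝ), ∀ G u : Fn, Smooth G → IsWaveSol c G u →
      ∀ (t : ℝ) (x : E3), 0 ≤ t →
        jb (t + ‖x‖) * (Phi (κ - 1) (c * t) ‖x‖)⁻¹ * |u t x| ≤
          C * Afun κ μ 0 G c cs t x := by
  obtain ⟨C₁, hC₁, hC₁le⟩ := exists_jb_mul_integral_le hκ
  set K := (N + 1) * (∫ z, jb z ^ (-(1 + μ))) / c with hK
  have hK0 : 0 ≤ K := by
    have : 0 ≤ ∫ z, jb z ^ (-(1 + μ)) :=
      integral_nonneg fun z => Real.rpow_nonneg (jb_pos _).le _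
    positivity
  have hpi := Real.pi_pos
  set m := max 1 c⁻¹ with hm
  have hm1 : 1 ≤ m := le_max_left _ _
  set C₂ := m * max 1 c ^ κ * K * (C₁ + 2 * Real.pi) / (2 * c) with hC₂
  have hC₂0 : 0 ≤ C₂ := by positivity
  refine ⟨C₂ + 1, by positivity, fun G u hG hu t x ht => ?_⟩
  have hA := Afun_nonneg cs (G := G) c κ μ t x
  have hPhi := Phi_pos (κ - 1) (c * t) ‖x‖
  have hct : 0 ≤ c * t := by positivity
  have hbracket : jb (t + ‖x‖) ≤ m * jb (c * t + ‖x‖) := by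
    refine (jb_le_jb ?_).trans (jb_mul_le hm1 _)
    rw [abs_of_nonneg (by positivity), abs_of_nonneg (by positivity)]
    have h1 : t ≤ m * (c * t) := by
      calc t = c⁻¹ * (c * t) := by field_simp
        _ ≤ _ := by gcongr; exact le_max_right _ _
    nlinarith [norm_nonneg x]
  set D := max 1 c ^ κ * Afun κ μ 0 G c cs t x with hD
  have hD0 : 0 ≤ D := by positivity
  have hu' : jb (c * t + ‖x‖) * (2 * c * |u t x|) ≤
      D * K * (C₁ + 2 * Real.pi) * Phi (κ - 1) (c * t) ‖x‖ := by
    have hj := jb_pos (c * t + ‖x‖)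
    rcases (norm_nonneg x).eq_or_lt with h0 | h0
    · obtain rfl : x = 0 := norm_eq_zero.1 h0.symm
      have h1 := abs_le_at_origin cs hc hcs hκ hμ hG hu ht
      have h2 := jb_rpow_le_two_mul_Phi κ (c * t) 0
      rw [sub_zero] at h2
      rw [norm_zero, add_zero] at *
      calc jb (c * t) * (2 * c * |u t 0|)
          ≤ jb (c * t) * (Real.pi * (D * K * jb (c * t) ^ (-κ))) := by gcongr
        _ = Real.pi * (D * K) * jb (c * t) ^ (1 - κ) := by
          rw [sub_eq_add_neg, Real.rpow_add hj, Real.rpow_one]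
          ring
        _ ≤ Real.pi * (D * K) * (2 * Phi (κ - 1) (c * t) 0) := by gcongr
        _ = D * K * (2 * Real.pi) * Phi (κ - 1) (c * t) 0 := by ring
        _ ≤ _ := by gcongr; linarith
    · have h1 := abs_le_of_pos_norm cs hc hcs hκ hμ hG hu ht h0
      calc jb (c * t + ‖x‖) * (2 * c * |u t x|)
          ≤ jb (c * t + ‖x‖) * (D * K *
            ((∫ ξ in |c * t - ‖x‖|..c * t + ‖x‖, jb ξ ^ (-κ)) / ‖x‖)) := by gcongr
        _ = D * K * (jb (c * t + ‖x‖) *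
            ((∫ ξ in |c * t - ‖x‖|..c * t + ‖x‖, jb ξ ^ (-κ)) / ‖x‖)) := by ring
        _ ≤ D * K * (C₁ * Phi (κ - 1) (c * t) ‖x‖) := 
          mul_le_mul_of_nonneg_left (hC₁le _ _ hct h0) (by positivity)
        _ = D * K * C₁ * Phi (κ - 1) (c * t) ‖x‖ := by ring
        _ ≤ _ := by gcongr; linarith
  calc jb (t + ‖x‖) * (Phi (κ - 1) (c * t) ‖x‖)⁻¹ * |u t x|
      ≤ m * jb (c * t + ‖x‖) * (Phi (κ - 1) (c * t) ‖x‖)⁻¹ * |u t x| := by gcongr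
    _ = m * (jb (c * t + ‖x‖) * (2 * c * |u t x|)) / (2 * c * Phi (κ - 1) (c * t) ‖x‖) := by
      field_simp
    _ ≤ m * (D * K * (C₁ + 2 * Real.pi) * Phi (κ - 1) (c * t) ‖x‖) /
          (2 * c * Phi (κ - 1) (c * t) ‖x‖) := by gcongr
    _ = C₂ * Afun κ μ 0 G c cs t x := by
      rw [hC₂, hD]
      field_simp
    _ ≤ _ := by gcongr; linarith
end PaperKatayama
end
end

section
/- Let c>0 and let v,w be smooth functions on (0,∞)×ℝ³. Then for every (t,x) with t>0 and x≠0, writing r=|x| and ω=x/r, Q_0(v,w;c)(t,x) = (1/t²)·(Sv+(ct−r)∂_r v)·(Sw−(ct+r)∂_r w)(t,x) + (c/t)·{ (Sv)(∂_r w) − (∂_r v)(Sw) }(t,x) + (c²/r)·Σ_{j≠k} ω_k·(∂_j v)(Ω_{jk}w)(t,x), where the last sum runs over ordered pairs (j,k) with j≠k, and Ω_{jk}=−Ω_{kj} for j>k. -/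
noncomputable section

namespace PaperKatayama

theorem stmt9 (c : ℝ) (hc : 0 < c) (v w : Fn) (hv : Smooth v) (hw : Smooth w)
    (t : ℝ) (ht : 0 < t) (x : E3) (hx : x ≠ 0) :
    Q0f c v w t x =
      (1 / t ^ 2) * ((Sc v t x + (c * t - ‖x‖) * pr v t x) *
          (Sc w t x - (c * t + ‖x‖) * pr w t x)) +
        (c / t) * (Sc v t x * pr w t x - pr v t x * Sc w t x) +
        (c ^ 2 / ‖x‖) * ∑ p ∈ Finset.univ.filter (fun p : Fin 3 × Fin 3 => p.1 ≠ p.2),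
          (x p.2 / ‖x‖) * (pd p.1 v t x * rotA p.1 p.2 w t x) := by
  have hr : ‖x‖ ≠ 0 := norm_ne_zero_iff.mpr hx
  have hsq : ‖x‖ ^ 2 = x 0 ^ 2 + x 1 ^ 2 + x 2 ^ 2 := by
    rw [EuclideanSpace.real_norm_sq_eq, Fin.sum_univ_three]
  simp only [Finset.sum_filter, Fintype.sum_prod_type, Fin.sum_univ_three, Q0f, Sc, pr, rotA]
  simp only [ne_eq, Fin.reduceEq, not_true_eq_false, not_false_eq_true, if_true, if_false]
  field_simp
  linear_combination (-c ^ 2 * t ^ 2 *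
    (pd 0 v t x * pd 0 w t x + pd 1 v t x * pd 1 w t x + pd 2 v t x * pd 2 w t x)) * hsq

end PaperKatayama
end
end
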